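/- Let g ≤ α ≤ β ≤ 1, x ∈ [α−1, α), z ∈ [β−1, β). If x + z = 0 or (x+1)(z+1) = 1, then T_α(x) + T_β(z) ∈ {0, 1}. -/

import Mathlib

open MeasureTheory Set

noncomputable def g : ℝ := (Real.sqrt 5 - 1) / 2

noncomputable def T (α : ℝ) (x : ℝ) : ℝ :=
  if x = 0 then 0 else 1 / x - ⌊1 / x + 1 - α⌋

noncomputable def digit (α : ℝ) (k : ℕ) (x : ℝ) : ℤ :=
  if (T α)^[k - 1] x = 0 then 0 else ⌊1 / ((T α)^[k - 1] x) + 1 - α⌋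

noncomputable def cylinder (α : ℝ) (n : ℕ) (a : ℕ → ℤ) : Set ℝ :=
  {x | x ∈ Set.Ico (α - 1) α ∧ ∀ k, 1 ≤ k → k ≤ n → digit α k x = a k}

def contQ (a : ℕ → ℤ) : ℕ → ℤ
  | 0 => 1
  | 1 => a 1
  | (n + 2) => a (n + 2) * contQ a (n + 1) + contQ a n

def contP (a : ℕ → ℤ) : ℕ → ℤ
  | 0 => 0
  | 1 => 1
  | (n + 2) => a (n + 2) * contP a (n + 1) + contP a n

noncomputable def NT (α : ℝ) (p : ℝ × ℝ) : ℝ × ℝ :=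
  if p.1 = 0 then (0, 0)
  else (1 / p.1 - ⌊1 / p.1 + 1 - α⌋, 1 / (p.2 + ⌊1 / p.1 + 1 - α⌋))

noncomputable def Omega (α : ℝ) : Set (ℝ × ℝ) :=
  ⋃ n : ℕ, closure ((NT α)^[n] '' (Set.Ico (α - 1) α ×ˢ ({0} : Set ℝ)))

def Sset (x y : ℝ) : Set (ℝ × ℝ) :=
  {(x, y), (-x, -y), (x + 1, y / (1 - y)), (1 - x, -y / (y + 1))}

noncomputable def jumpTime (α : ℝ) (x : ℝ) : ℕ :=
  sInf {n : ℕ | 1 ≤ n ∧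
    (T α)^[n] '' cylinder α n (fun k => digit α k x) = Set.Ico (α - 1) α}

noncomputable def jumpT (α : ℝ) (x : ℝ) : ℝ := (T α)^[jumpTime α x] x

lemma half_lt_g : 1 / 2 < g := by
  have h : (2 : ℝ) < Real.sqrt 5 := Real.lt_sqrt_of_sq_lt (by norm_num)
  unfold g
  linarith

lemma T_mem_Ico {α x : ℝ} (hx : x ≠ 0) : T α x ∈ Set.Ico (α - 1) α := by
  have h₁ := Int.floor_le (1 / x + 1 - α)
  have h₂ := Int.lt_floor_add_one (1 / x + 1 - α)
  simp only [T, if_neg hx]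
  constructor <;> linarith

lemma T_add_T_mem_of_inv_add_inv {α β x z : ℝ} (hα : 1 / 2 < α) (hα' : α ≤ 1)
    (hβ : 1 / 2 < β) (hβ' : β ≤ 1) (hx : x ≠ 0) (hz : z ≠ 0) (n : ℤ)
    (h : 1 / x + 1 / z = n) : T α x + T β z ∈ ({0, 1} : Set ℝ) := by
  obtain ⟨hx₁, hx₂⟩ := T_mem_Ico (α := α) hx
  obtain ⟨hz₁, hz₂⟩ := T_mem_Ico (α := β) hz
  obtain ⟨m, hm⟩ : ∃ m : ℤ, T α x + T β z = m := by
    refine ⟨n - ⌊1 / x + 1 - α⌋ - ⌊1 / z + 1 - β⌋, ?_⟩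
    simp only [T, if_neg hx, if_neg hz]
    push_cast
    linarith
  have h₁ : (-1 : ℤ) < m := by
    have : ((-1 : ℤ) : ℝ) < m := by push_cast; linarith
    exact_mod_cast this
  have h₂ : m < (2 : ℤ) := by
    have : (m : ℝ) < ((2 : ℤ) : ℝ) := by push_cast; linarith
    exact_mod_cast this
  obtain rfl | rfl : m = 0 ∨ m = 1 := by omega
  all_goals simp [hm]

/-- If x + z = 0 or (x+1)(z+1) = 1, then T_α(x) + T_β(z) ∈ {0, 1}. -/
theorem synchronization_sum (α β x z : ℝ)
    (hαβ : g ≤ α) (hαβ' : α ≤ β) (hβ : β ≤ 1)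
    (hx : x ∈ Set.Ico (α - 1) α) (hz : z ∈ Set.Ico (β - 1) β)
    (h : x + z = 0 ∨ (x + 1) * (z + 1) = 1) :
    T α x + T β z ∈ ({0, 1} : Set ℝ) := by
  have hg := half_lt_g
  by_cases hx₀ : x = 0
  · have hz₀ : z = 0 := by rcases h with h | h <;> subst hx₀ <;> linarith
    simp [T, hx₀, hz₀]
  have hz₀ : z ≠ 0 := by
    rintro rfl
    exact hx₀ (by rcases h with h | h <;> linarith)
  rcases h with h | h
  · refine T_add_T_mem_of_inv_add_inv (by linarith) (by linarith) (by linarith) hβ hx₀ hz₀ 0 ?_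
    field_simp
    push_cast
    linarith
  · refine T_add_T_mem_of_inv_add_inv (by linarith) (by linarith) (by linarith) hβ hx₀ hz₀ (-1) ?_
    field_simp
    push_cast
    linarith
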